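/- Every g-invariant subspace U of a finite-dimensional real representation V of a real semisimple Lie algebra g has a g-invariant complementary subspace W with V = U ⊕ W. -/

import Mathlib

namespace WeylAux
open LieModule LieAlgebra

attribute [local instance] LieRing.ofAssociativeRing

/-- The image of a semisimple Lie algebra has trivial radical. -/
lemma trivialRadical_of_surjective {g L : Type*} [LieRing g] [LieAlgebra ℝ g]
    [LieAlgebra.IsSemisimple ℝ g] [LieRing L] [LieAlgebra ℝ L] (f : g →ₗ⁅ℝ⁆ L)
    (hf : Function.Surjective f) : HasTrivialRadical ℝ L := by
  rw [hasTrivialRadical_iff_no_abelian_ideals]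
  intro I hI
  obtain ⟨C, hC⟩ := exists_isCompl f.ker
  have hA : IsLieAbelian (I.comap f ⊓ C : LieIdeal ℝ g) := by
    constructor
    rintro ⟨x, hx⟩ ⟨y, hy⟩
    rw [LieSubmodule.mem_inf] at hx hy
    have h1 : ⁅x, y⁆ ∈ C := lie_mem_right ℝ g C x y hy.2
    have h2 : ⁅x, y⁆ ∈ f.ker := by
      rw [LieHom.mem_ker, LieHom.map_lie]
      have := hI.trivial ⟨f x, LieIdeal.mem_comap.mp hx.1⟩ ⟨f y, LieIdeal.mem_comap.mp hy.1⟩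
      simpa using congrArg Subtype.val this
    have h3 : ⁅x, y⁆ ∈ (f.ker ⊓ C : LieIdeal ℝ g) := LieSubmodule.mem_inf _ _ _ |>.mpr ⟨h2, h1⟩
    rw [hC.inf_eq_bot, LieSubmodule.mem_bot] at h3
    ext
    exact h3
  have hbot : I.comap f ⊓ C = ⊥ :=
    (hasTrivialRadical_iff_no_abelian_ideals ℝ g).mp inferInstance _ hA
  have hle : I.comap f ≤ f.ker := by
    have : I.comap f = I.comap f ⊓ (f.ker ⊔ C) := by rw [hC.sup_eq_top, inf_top_eq]
    rw [this, inf_sup_left, hbot, sup_bot_eq]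
    exact inf_le_right
  rw [eq_bot_iff]
  intro z hz
  obtain ⟨x, rfl⟩ := hf z
  exact LieHom.mem_ker.mp (hle (LieIdeal.mem_comap.mpr hz))

variable {M : Type*} [AddCommGroup M] [Module ℝ M] [FiniteDimensional ℝ M]

lemma traceForm_nondegenerate (L : LieSubalgebra ℝ (Module.End ℝ M)) [HasTrivialRadical ℝ L] :
    (traceForm ℝ L M).Nondegenerate := by
  let I : LieIdeal ℝ L :=
    LieAlgebra.InvariantForm.orthogonal (traceForm ℝ L M) (traceForm_lieInvariant ℝ L M) ⊤
  have hI0 : traceForm ℝ I M = 0 := by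
    ext ⟨x, hx⟩ ⟨y, hy⟩
    exact (LieAlgebra.InvariantForm.mem_orthogonal _ _ _ _).mp hy x (LieSubmodule.mem_top _)
  have hnil := isNilpotent_derivedSeries_of_traceForm_eq_zero hI0
  have hN : LieRing.IsNilpotent (derivedSeries ℝ I 1) := by
    rw [LieAlgebra.isNilpotent_iff_forall (R := ℝ)]
    intro x
    apply LieSubalgebra.isNilpotent_ad_of_isNilpotent_ad (derivedSeries ℝ I 1 : LieSubalgebra ℝ I)
    apply LieSubalgebra.isNilpotent_ad_of_isNilpotent_ad (I : LieSubalgebra ℝ L)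
    apply LieAlgebra.isNilpotent_ad_of_isNilpotent (L := L)
    exact (LieModule.isNilpotent_iff_forall' (R := ℝ)).mp hnil x
  have hS : IsSolvable I := by
    obtain ⟨k, hk⟩ := IsSolvable.solvable ℝ (derivedSeries ℝ I 1)
    rw [LieIdeal.derivedSeries_eq_bot_iff] at hk
    refine IsSolvable.mk (R := ℝ) (k := k + 1) ?_
    rw [derivedSeries_def, derivedSeriesOfIdeal_add]
    exact hk
  have hb : I = ⊥ := HasTrivialRadical.eq_bot_of_isSolvable I
  have key : ∀ x, (∀ y, traceForm ℝ L M x y = 0) → x = 0 := by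
    intro x hx
    have : x ∈ I := (LieAlgebra.InvariantForm.mem_orthogonal _ _ _ _).mpr
      fun y _ => by rw [traceForm_comm]; exact hx y
    rwa [hb, LieSubmodule.mem_bot] at this
  refine ⟨fun x hx => key x hx, fun x hx => key x fun y => by rw [traceForm_comm]; exact hx y⟩

/-- The Casimir element. -/
lemma exists_casimir (L : LieSubalgebra ℝ (Module.End ℝ M)) [HasTrivialRadical ℝ L]
    [Nontrivial L] :
    ∃ c : Module.End ℝ M, (∀ x ∈ L, x * c = c * x) ∧ ¬ IsNilpotent c ∧
      ∀ U : Submodule ℝ M, (∀ x ∈ L, ∀ m, x m ∈ U) → ∀ m, c m ∈ U := by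
  classical
  have hB := traceForm_nondegenerate L
  have hs : (traceForm ℝ L M).IsSymm := ⟨traceForm_comm ℝ L M⟩
  let b := Module.finBasis ℝ L
  let B := traceForm ℝ L M
  let d := B.dualBasis hB b
  have hd : ∀ z, z = ∑ i, B z (b i) • d i := fun z => by
    conv_lhs => rw [← d.sum_repr z]
    simp [d, B]
  have hb : ∀ z, z = ∑ i, B z (d i) • b i := fun z => by
    have h := (B.dualBasis hB d).sum_repr z
    have h' : B.dualBasis hB d = b := LinearMap.BilinForm.dualBasis_dualBasis hB hs b
    simp only [LinearMap.BilinForm.dualBasis_repr_apply] at h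
    rw [h'] at h
    exact h.symm
  refine ⟨∑ i, (b i : Module.End ℝ M) * (d i : Module.End ℝ M), ?_, ?_, ?_⟩
  · intro x hx
    let X : L := ⟨x, hx⟩
    have e1 : ∀ i, x * (b i : Module.End ℝ M) - b i * x =
        ∑ j, B ⁅X, b i⁆ (d j) • (b j : Module.End ℝ M) := fun i => by
      have := congrArg (Subtype.val) (hb ⁅X, b i⁆)
      rw [AddSubmonoidClass.coe_finsetSum] at this
      exact this
    have e2 : ∀ i, x * (d i : Module.End ℝ M) - d i * x =
        ∑ j, B ⁅X, d i⁆ (b j) • (d j : Module.End ℝ M) := fun i => by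
      have := congrArg (Subtype.val) (hd ⁅X, d i⁆)
      rw [AddSubmonoidClass.coe_finsetSum] at this
      exact this
    rw [← sub_eq_zero, Finset.mul_sum, Finset.sum_mul, ← Finset.sum_sub_distrib]
    have e3 : ∀ i, x * ((b i : Module.End ℝ M) * d i) - b i * d i * x =
        (x * b i - b i * x) * d i + b i * (x * d i - d i * x) := fun i => by noncomm_ring
    simp_rw [e3, e1, e2, Finset.sum_add_distrib, Finset.sum_mul, Finset.mul_sum]
    rw [Finset.sum_comm, ← Finset.sum_add_distrib]
    refine Finset.sum_eq_zero fun i _ => ?_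
    rw [← Finset.sum_add_distrib]
    refine Finset.sum_eq_zero fun j _ => ?_
    have : B ⁅X, b j⁆ (d i) = - B ⁅X, d i⁆ (b j) := by
      rw [show B ⁅X, b j⁆ (d i) = _ from traceForm_apply_lie_apply' ℝ L M X (b j) (d i)]
      rw [show B ⁅X, d i⁆ (b j) = _ from traceForm_comm ℝ L M _ _]
    rw [this, smul_mul_assoc, mul_smul_comm, neg_smul, neg_add_cancel]
  · intro hn
    have h0 := (LinearMap.isNilpotent_trace_of_isNilpotent hn).eq_zero
    rw [map_sum] at h0
    have : ∀ i, LinearMap.trace ℝ M ((b i : Module.End ℝ M) * d i) = 1 := fun i => by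
      have := LinearMap.BilinForm.apply_dualBasis_right hB hs b i i
      rw [if_pos rfl] at this
      exact this
    simp only [this] at h0
    have hpos := Module.finrank_pos (R := ℝ) (M := L)
    rw [Finset.sum_const, Finset.card_univ, Fintype.card_fin, nsmul_eq_mul, mul_one,
      Nat.cast_eq_zero] at h0
    omega
  · intro U hU m
    rw [LinearMap.sum_apply]
    exact Submodule.sum_mem _ fun i _ => hU _ (b i).2 _

/-- First Whitehead lemma, in the form: if `g M ⊆ U ≠ M` there is an invariant vector
outside `U`. -/
lemma exists_invariant (g : Type*) [LieRing g] [LieAlgebra ℝ g] [LieAlgebra.IsSemisimple ℝ g]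
    (n : ℕ) : ∀ (M : Type*) [AddCommGroup M] [Module ℝ M] [FiniteDimensional ℝ M]
    [LieRingModule g M] [LieModule ℝ g M] (U : Submodule ℝ M), Module.finrank ℝ M = n →
    (∀ (x : g) (m : M), ⁅x, m⁆ ∈ U) → U ≠ ⊤ → ∃ v, v ∉ U ∧ ∀ x : g, ⁅x, v⁆ = 0 := by
  induction n using Nat.strong_induction_on with
  | _ n ih =>
  intro M _ _ _ _ _ U hn hU hne
  let L := (toEnd ℝ g M).range
  have : HasTrivialRadical ℝ L :=
    trivialRadical_of_surjective (toEnd ℝ g M).rangeRestrict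
      (toEnd ℝ g M).surjective_rangeRestrict
  rcases subsingleton_or_nontrivial L with hL | hL
  · obtain ⟨v, hv⟩ : ∃ v, v ∉ U := by
      by_contra! h
      exact hne (eq_top_iff.mpr fun v _ => h v)
    refine ⟨v, hv, fun x => ?_⟩
    have : (⟨toEnd ℝ g M x, ⟨x, rfl⟩⟩ : L) = 0 := Subsingleton.elim _ _
    exact LinearMap.congr_fun (congrArg Subtype.val this) v
  · obtain ⟨c, hc, hnil, hcU⟩ := exists_casimir L
    obtain ⟨k, hk⟩ := Filter.eventually_atTop.mp
      (LinearMap.eventually_isCompl_ker_pow_range_pow c)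
    specialize hk (k + 1) (Nat.le_succ k)
    have hcomm : ∀ (x : g), Commute (toEnd ℝ g M x) (c ^ (k + 1)) := fun x =>
      Commute.pow_right (hc _ ⟨x, rfl⟩) _
    let N : LieSubmodule ℝ g M :=
      { LinearMap.ker (c ^ (k + 1)) with
        lie_mem := by
          intro x m hm
          change (c ^ (k + 1)) m = 0 at hm
          change (c ^ (k + 1)) ⁅x, m⁆ = 0
          have := LinearMap.congr_fun (hcomm x) m
          simp only [Module.End.mul_apply, hm, map_zero, toEnd_apply_apply] at this
          exact this.symm }
    have hrU : LinearMap.range (c ^ (k + 1)) ≤ U := by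
      rintro _ ⟨m, rfl⟩
      rw [pow_succ', Module.End.mul_apply]
      exact hcU U (by rintro _ ⟨x, rfl⟩ m; exact hU x m) _
    have hlt : Module.finrank ℝ N < n := by
      rw [← hn]
      apply Submodule.finrank_lt (s := LinearMap.ker (c ^ (k + 1)))
      intro h
      exact hnil ⟨k + 1, LinearMap.ker_eq_top.mp h⟩
    obtain ⟨v, hv, hv'⟩ := ih _ hlt N (U.comap N.toSubmodule.subtype) rfl
      (fun x m => hU x m) (by
        intro h
        rw [Submodule.comap_subtype_eq_top] at h
        apply hne
        rw [eq_top_iff, ← hk.sup_eq_top]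
        exact sup_le h hrU)
    exact ⟨v, hv, fun x => congrArg Subtype.val (hv' x)⟩

end WeylAux

theorem every_invariant_subspace_has_invariant_complement
    (g : Type*) [LieRing g] [LieAlgebra ℝ g] [LieAlgebra.IsSemisimple ℝ g]
    (V : Type*) [AddCommGroup V] [Module ℝ V] [FiniteDimensional ℝ V]
    [LieRingModule g V] [LieModule ℝ g V]
    (U : LieSubmodule ℝ g V) :
    ∃ W : LieSubmodule ℝ g V, IsCompl U W := by
  by_cases hU : U = ⊥
  · exact ⟨⊤, hU ▸ isCompl_bot_top⟩
  obtain ⟨u, huU, hu0⟩ : ∃ u ∈ U, u ≠ 0 := by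
    by_contra! h
    exact hU ((LieSubmodule.eq_bot_iff _).mpr h)
  -- maps `V → U` acting on `U` by a scalar
  let H : LieSubmodule ℝ g (V →ₗ[ℝ] V) :=
    { carrier := {f | (∀ v, f v ∈ U) ∧ ∃ a : ℝ, ∀ w ∈ U, f w = a • w}
      add_mem' := by
        rintro f f' ⟨h, a, ha⟩ ⟨h', a', ha'⟩
        exact ⟨fun v => U.add_mem (h v) (h' v), a + a', fun w hw => by
          simp [ha w hw, ha' w hw, add_smul]⟩
      zero_mem' := ⟨fun v => U.zero_mem, 0, fun w hw => by simp⟩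
      smul_mem' := by
        rintro t f ⟨h, a, ha⟩
        exact ⟨fun v => U.smul_mem t (h v), t * a, fun w hw => by
          simp [ha w hw, mul_smul]⟩
      lie_mem := by
        rintro x f ⟨h, a, ha⟩
        refine ⟨fun v => ?_, 0, fun w hw => ?_⟩
        · rw [LieHom.lie_apply]
          exact U.sub_mem (U.lie_mem (h v)) (h _)
        · rw [LieHom.lie_apply, ha w hw, ha _ (U.lie_mem hw), lie_smul, sub_self, zero_smul] }
  let H0 : Submodule ℝ H :=
    { carrier := {f | ∀ w ∈ U, (f : V →ₗ[ℝ] V) w = 0}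
      add_mem' := by
        intro f f' h h' w hw
        change (f : V →ₗ[ℝ] V) w + (f' : V →ₗ[ℝ] V) w = 0
        rw [h w hw, h' w hw, add_zero]
      zero_mem' := fun w hw => rfl
      smul_mem' := by
        intro t f h w hw
        change t • (f : V →ₗ[ℝ] V) w = 0
        rw [h w hw, smul_zero] }
  have hH0 : ∀ (x : g) (f : H), ⁅x, f⁆ ∈ H0 := by
    rintro x ⟨f, h, a, ha⟩ w hw
    change ⁅x, f⁆ w = 0
    rw [LieHom.lie_apply, ha w hw, ha _ (U.lie_mem hw), lie_smul, sub_self]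
  have hne : H0 ≠ ⊤ := by
    intro h
    obtain ⟨p, hp⟩ := U.toSubmodule.exists_isCompl
    let P : V →ₗ[ℝ] V := U.toSubmodule.subtype ∘ₗ Submodule.projectionOnto U.toSubmodule p hp
    have hP : ∀ w ∈ U, P w = w := fun w hw => by
      have := Submodule.projectionOnto_apply_left hp ⟨w, hw⟩
      exact congrArg Subtype.val this
    have hPH : P ∈ H := ⟨fun v => (Submodule.projectionOnto U.toSubmodule p hp v).2, 1,
      fun w hw => by rw [hP w hw, one_smul]⟩
    have : (⟨P, hPH⟩ : H) ∈ H0 := by rw [h]; trivial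
    exact hu0 ((hP u huU).symm.trans (this u huU))
  obtain ⟨⟨f, hfU, a, ha⟩, hf0, hfi⟩ := WeylAux.exists_invariant g _ H H0 rfl hH0 hne
  have ha0 : a ≠ 0 := by
    rintro rfl
    exact hf0 fun w hw => by simpa using ha w hw
  have hcomm : ∀ (x : g) v, f ⁅x, v⁆ = ⁅x, f v⁆ := fun x v => by
    have h1 : ⁅x, f⁆ = 0 := congrArg Subtype.val (hfi x)
    have h2 := LinearMap.congr_fun h1 v
    rw [LieHom.lie_apply, LinearMap.zero_apply, sub_eq_zero] at h2
    exact h2.symm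
  let W : LieSubmodule ℝ g V :=
    { LinearMap.ker f with
      lie_mem := by
        intro x m hm
        change f m = 0 at hm
        change f ⁅x, m⁆ = 0
        rw [hcomm, hm, lie_zero] }
  refine ⟨W, ?_⟩
  rw [← LieSubmodule.isCompl_toSubmodule]
  constructor
  · rw [Submodule.disjoint_def]
    intro w hw hw'
    have h1 : f w = 0 := hw'
    rw [ha w hw] at h1
    exact (smul_eq_zero.mp h1).resolve_left ha0
  · rw [codisjoint_iff, eq_top_iff]
    intro v _
    rw [Submodule.mem_sup]
    refine ⟨a⁻¹ • f v, U.smul_mem _ (hfU v), v - a⁻¹ • f v, ?_, by abel⟩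
    change f (v - a⁻¹ • f v) = 0
    rw [map_sub, map_smul, ha _ (hfU v), smul_smul, inv_mul_cancel₀ ha0, one_smul, sub_self]
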